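/- arXiv:1803.03669 — 2 statements merged into one kernel-verified Lean document; each statement's English description precedes it below -/
import Mathlib

section
/- Assume n ≥ 2 and ‖z̄ − h̄‖₂ ≤ δ√n for some δ ∈ [0,1]. If z̄ is not orthogonal to N(H), then (TRS) has a unique global minimizer ĝ, and it satisfies (1/n)⟨h̄, ĝ⟩ ≥ 1 − 3δ/2 − λπ²M²(2k)^{2α+1}/n^{2α} + (1/(4λk + 1)²)·(1/(2n))·z̄ᵀHz̄. -/
open scoped BigOperators
noncomputable section

namespace ModOne

/-- Grid points `x_i = (i-1)/(n-1)`, with `i : Fin n` zero-indexed. -/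
def gridPt (n : ℕ) (i : Fin n) : ℝ := (i : ℝ) / ((n : ℝ) - 1)

/-- Adjacency of the path-power graph: `i ≠ j` and `|i − j| ≤ k`. -/
def adj (n k : ℕ) (i j : Fin n) : Prop := i ≠ j ∧ |(i : ℤ) - (j : ℤ)| ≤ (k : ℤ)

instance adjDec (n k : ℕ) (i : Fin n) : DecidablePred (adj n k i) := fun j =>
  inferInstanceAs (Decidable (i ≠ j ∧ |(i : ℤ) - (j : ℤ)| ≤ (k : ℤ)))

/-- Degree of vertex `i` in the graph `G`. -/
def deg (n k : ℕ) (i : Fin n) : ℕ := (Finset.univ.filter (adj n k i)).card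

/-- The graph Laplacian `L` of `G`. -/
def lap (n k : ℕ) : Matrix (Fin n) (Fin n) ℝ := fun i j =>
  if i = j then (deg n k i : ℝ) else if adj n k i j then -1 else 0

/-- The block-diagonal matrix `H` with both diagonal blocks equal to `λL`. -/
def Hmat (n k : ℕ) (lam : ℝ) : Matrix (Fin n ⊕ Fin n) (Fin n ⊕ Fin n) ℝ :=
  Matrix.fromBlocks (lam • lap n k) 0 0 (lam • lap n k)

/-- The angular embedding `circ t = exp(2πι t)`. -/
def circ (t : ℝ) : ℂ := Complex.exp (2 * Real.pi * Complex.I * (t : ℂ))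

/-- Real representation `(Re v, Im v) ∈ ℝ^{2n}` of a complex vector `v ∈ ℂ^n`. -/
def embed (n : ℕ) (v : Fin n → ℂ) : Fin n ⊕ Fin n → ℝ :=
  Sum.elim (fun i => (v i).re) (fun i => (v i).im)

/-- Real representation of the angular embedding of a vector of values `t : Fin n → ℝ`. -/
def cvec (n : ℕ) (t : Fin n → ℝ) : Fin n ⊕ Fin n → ℝ := embed n (fun i => circ (t i))

/-- Quadratic form `vᵀ A v`. -/
def quad (n : ℕ) (A : Matrix (Fin n ⊕ Fin n) (Fin n ⊕ Fin n) ℝ) (v : Fin n ⊕ Fin n → ℝ) : ℝ :=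
  ∑ i, v i * A.mulVec v i

/-- Euclidean inner product on `ℝ^{2n}`. -/
def dotR (n : ℕ) (u v : Fin n ⊕ Fin n → ℝ) : ℝ := ∑ i, u i * v i

/-- Euclidean norm on `ℝ^{2n}`. -/
def norm2 (n : ℕ) (v : Fin n ⊕ Fin n → ℝ) : ℝ := Real.sqrt (∑ i, (v i) ^ 2)

/-- Feasibility for (TRS): `‖g‖₂² = n`. -/
def feasible (n : ℕ) (g : Fin n ⊕ Fin n → ℝ) : Prop := ∑ i, (g i) ^ 2 = (n : ℝ)

/-- The (TRS) objective `ḡᵀHḡ − 2ḡᵀz̄`. -/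
def objective (n k : ℕ) (lam : ℝ) (zbar g : Fin n ⊕ Fin n → ℝ) : ℝ :=
  quad n (Hmat n k lam) g - 2 * dotR n g zbar

/-- `g` is a global minimizer of (TRS) with data `z̄`. -/
def minimizer (n k : ℕ) (lam : ℝ) (zbar g : Fin n ⊕ Fin n → ℝ) : Prop :=
  feasible n g ∧ ∀ g', feasible n g' → objective n k lam zbar g ≤ objective n k lam zbar g'

/-- `z̄` is orthogonal to the null space `N(H)` of `H`. -/
def perpNull (n k : ℕ) (lam : ℝ) (z : Fin n ⊕ Fin n → ℝ) : Prop :=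
  ∀ v, (Hmat n k lam).mulVec v = 0 → dotR n z v = 0

end ModOne

open Matrix in
/-- The secular equation of the trust-region subproblem: if `z` is not orthogonal to the null
space of a positive semidefinite `A`, some shift `μ ∈ (0, 1]` has `‖(A + μ)⁻¹ z‖ = ‖z‖`. -/
lemma exists_shift_solution_of_dotProduct_ne_zero {ι : Type*} [Fintype ι] [DecidableEq ι]
    (A : Matrix ι ι ℝ)
    (hsymm : ∀ u v, u ⬝ᵥ A *ᵥ v = v ⬝ᵥ A *ᵥ u) (hpos : ∀ v, 0 ≤ v ⬝ᵥ A *ᵥ v)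
    (z v : ι → ℝ) (hv : A *ᵥ v = 0) (hzv : z ⬝ᵥ v ≠ 0) :
    ∃ μ : ℝ, 0 < μ ∧ μ ≤ 1 ∧ ∃ g : ι → ℝ, A *ᵥ g + μ • g = z ∧ g ⬝ᵥ g = z ⬝ᵥ z := by
  have hself : ∀ w : ι → ℝ, 0 ≤ w ⬝ᵥ w := fun w =>
    Finset.sum_nonneg fun i _ => mul_self_nonneg (w i)
  have hcs : ∀ u w : ι → ℝ, (u ⬝ᵥ w) ^ 2 ≤ (u ⬝ᵥ u) * (w ⬝ᵥ w) := fun u w => by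
    simpa [dotProduct, sq] using Finset.sum_mul_sq_le_sq_mul_sq Finset.univ u w
  have hdet : ∀ μ : ℝ, 0 < μ → (A + μ • (1 : Matrix ι ι ℝ)).det ≠ 0 := by
    intro μ hμ h0
    obtain ⟨w, hw0, hw⟩ := Matrix.exists_mulVec_eq_zero_iff.mpr h0
    have h1 : w ⬝ᵥ A *ᵥ w + μ * (w ⬝ᵥ w) = 0 := by
      have := congrArg (fun t => w ⬝ᵥ t) hw
      simpa [add_mulVec, smul_mulVec, dotProduct_add, dotProduct_smul] using this
    have h2 : w ⬝ᵥ w = 0 := by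
      have := hpos w
      have := hself w
      nlinarith
    exact hw0 (dotProduct_self_eq_zero.mp h2)
  set s : ℝ → ι → ℝ := fun μ =>
    ((A + μ • (1 : Matrix ι ι ℝ)).det)⁻¹ • ((A + μ • (1 : Matrix ι ι ℝ)).adjugate *ᵥ z) with hs
  have hsolve : ∀ μ : ℝ, 0 < μ → A *ᵥ s μ + μ • s μ = z := by
    intro μ hμ
    have h1 : (A + μ • (1 : Matrix ι ι ℝ)) *ᵥ s μ = z := by
      simp only [hs, mulVec_smul, mulVec_mulVec, mul_adjugate, smul_mulVec, one_mulVec]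
      rw [smul_smul, inv_mul_cancel₀ (hdet μ hμ), one_smul]
    simpa [add_mulVec, smul_mulVec] using h1
  have hcontM : Continuous fun μ : ℝ => A + μ • (1 : Matrix ι ι ℝ) := by fun_prop
  have hcont : ContinuousOn (fun μ => s μ ⬝ᵥ s μ) (Set.Ioi 0) := by
    have hsc : ContinuousOn s (Set.Ioi 0) := by
      have h1 : ContinuousOn (fun μ : ℝ => ((A + μ • (1 : Matrix ι ι ℝ)).det)⁻¹) (Set.Ioi 0) :=
        hcontM.matrix_det.continuousOn.inv₀ fun μ hμ => hdet μ hμ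
      have h2 : Continuous fun μ : ℝ => (A + μ • (1 : Matrix ι ι ℝ)).adjugate *ᵥ z :=
        hcontM.matrix_adjugate.matrix_mulVec continuous_const
      exact h1.smul h2.continuousOn
    have hd : Continuous fun w : ι → ℝ => w ⬝ᵥ w := continuous_id.dotProduct continuous_id
    exact hd.comp_continuousOn hsc
  have hzvpos : 0 < (z ⬝ᵥ v) ^ 2 := by positivity
  have hD : 0 < (z ⬝ᵥ z) * (v ⬝ᵥ v) := hzvpos.trans_le (hcs z v)
  set μ₀ : ℝ := (z ⬝ᵥ v) ^ 2 / ((z ⬝ᵥ z) * (v ⬝ᵥ v)) with hμ₀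
  have hμ₀pos : 0 < μ₀ := by positivity
  have hμ₀le : μ₀ ≤ 1 := (div_le_one hD).mpr (hcs z v)
  have hlow : s 1 ⬝ᵥ s 1 ≤ z ⬝ᵥ z := by
    have h1 := hsolve 1 one_pos
    have h2 : z ⬝ᵥ z = A *ᵥ s 1 ⬝ᵥ A *ᵥ s 1 + 2 * (s 1 ⬝ᵥ A *ᵥ s 1) + s 1 ⬝ᵥ s 1 := by
      conv_lhs => rw [← h1]
      simp only [one_smul, add_dotProduct, dotProduct_add, dotProduct_comm (A *ᵥ s 1) (s 1)]
      ring
    linarith [hself (A *ᵥ s 1), hpos (s 1)]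
  have hhigh : z ⬝ᵥ z ≤ s μ₀ ⬝ᵥ s μ₀ := by
    have h1 : z ⬝ᵥ v = μ₀ * (s μ₀ ⬝ᵥ v) := by
      conv_lhs => rw [← hsolve μ₀ hμ₀pos]
      rw [add_dotProduct, smul_dotProduct, dotProduct_comm, hsymm, hv]
      simp
    have h2 : (z ⬝ᵥ v) ^ 2 = μ₀ * ((z ⬝ᵥ z) * (v ⬝ᵥ v)) := by
      rw [hμ₀, div_mul_cancel₀ _ hD.ne']
    have hzz : 0 < z ⬝ᵥ z := (hself z).lt_of_ne (fun h => by simp [← h] at hD)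
    have hvv : 0 < v ⬝ᵥ v := (hself v).lt_of_ne (fun h => by simp [← h] at hD)
    have h3 : (z ⬝ᵥ z) * (v ⬝ᵥ v) = μ₀ * (s μ₀ ⬝ᵥ v) ^ 2 := by
      have : μ₀ * ((z ⬝ᵥ z) * (v ⬝ᵥ v)) = μ₀ * (μ₀ * (s μ₀ ⬝ᵥ v) ^ 2) := by
        rw [← h2, h1]; ring
      exact mul_left_cancel₀ hμ₀pos.ne' this
    have h4 : (z ⬝ᵥ z) * (v ⬝ᵥ v) ≤ (s μ₀ ⬝ᵥ s μ₀) * (v ⬝ᵥ v) := by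
      refine le_trans ?_ (hcs (s μ₀) v)
      rw [h3]
      exact mul_le_of_le_one_left (sq_nonneg _) hμ₀le
    exact le_of_mul_le_mul_right h4 hvv
  obtain ⟨μ, hμ, hμeq⟩ := intermediate_value_Icc' hμ₀le
    (hcont.mono fun x hx => hμ₀pos.trans_le hx.1) ⟨hlow, hhigh⟩
  have hμpos : 0 < μ := hμ₀pos.trans_le hμ.1
  exact ⟨μ, hμpos, hμ.2, s μ, hsolve μ hμpos, hμeq⟩

open Matrix in
/-- If `‖A v‖² ≤ c vᵀAv` for all `v` and `(A + μ) g = z`, then `zᵀAz ≤ (c + μ)² gᵀAg`. -/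
lemma dotProduct_mulVec_le_of_shift {ι : Type*} [Fintype ι] (A : Matrix ι ι ℝ) (c μ : ℝ)
    (hc : 0 ≤ c) (hμ : 0 ≤ μ)
    (hsymm : ∀ u v, u ⬝ᵥ A *ᵥ v = v ⬝ᵥ A *ᵥ u)
    (hbound : ∀ v, A *ᵥ v ⬝ᵥ A *ᵥ v ≤ c * (v ⬝ᵥ A *ᵥ v))
    (g z : ι → ℝ) (hg : A *ᵥ g + μ • g = z) :
    z ⬝ᵥ A *ᵥ z ≤ (c + μ) ^ 2 * (g ⬝ᵥ A *ᵥ g) := by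
  set w := A *ᵥ g with hw
  have hself : 0 ≤ w ⬝ᵥ w := Finset.sum_nonneg fun i _ => mul_self_nonneg (w i)
  have hAw : w ⬝ᵥ A *ᵥ w ≤ c * (w ⬝ᵥ w) := by
    have hcs : (w ⬝ᵥ A *ᵥ w) ^ 2 ≤ (w ⬝ᵥ w) * (A *ᵥ w ⬝ᵥ A *ᵥ w) := by
      simpa [dotProduct, sq] using Finset.sum_mul_sq_le_sq_mul_sq Finset.univ w (A *ᵥ w)
    have h1 : (w ⬝ᵥ A *ᵥ w) ^ 2 ≤ (w ⬝ᵥ w) * (c * (w ⬝ᵥ A *ᵥ w)) :=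
      hcs.trans (mul_le_mul_of_nonneg_left (hbound w) hself)
    by_contra! hlt
    have h0 : 0 ≤ c * (w ⬝ᵥ w) := mul_nonneg hc hself
    nlinarith
  have hgw : g ⬝ᵥ A *ᵥ w = w ⬝ᵥ w := by rw [hsymm]
  have hexp : z ⬝ᵥ A *ᵥ z = w ⬝ᵥ A *ᵥ w + 2 * μ * (w ⬝ᵥ w) + μ ^ 2 * (g ⬝ᵥ w) := by
    rw [← hg]
    simp only [mulVec_add, mulVec_smul, add_dotProduct, dotProduct_add, smul_dotProduct,
      dotProduct_smul, smul_eq_mul, hgw, ← hw]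
    ring
  have hb := hbound g
  rw [← hw] at hb
  rw [hexp]
  nlinarith [mul_le_mul_of_nonneg_left hb hc, mul_le_mul_of_nonneg_left hb hμ]

namespace ModOne

lemma adj_comm (n k : ℕ) (i j : Fin n) : adj n k i j ↔ adj n k j i := by
  unfold adj
  rw [abs_sub_comm, ne_comm]

lemma deg_le (n k : ℕ) (i : Fin n) : deg n k i ≤ 2 * k := by
  unfold deg
  calc (Finset.univ.filter (adj n k i)).card
      ≤ ((Finset.Icc ((i : ℤ) - k) (i + k)).erase (i : ℤ)).card := by
        refine Finset.card_le_card_of_injOn (fun j : Fin n => ((j : ℕ) : ℤ)) ?_ ?_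
        · intro j hj
          have hj' : adj n k i j := by simpa using hj
          obtain ⟨h1, h2⟩ := hj'
          have h3 := abs_le.mp h2
          have h4 : (i : ℕ) ≠ j := fun h => h1 (Fin.ext h)
          simp only [Finset.coe_erase, Finset.coe_Icc, Set.mem_sdiff, Set.mem_Icc,
            Set.mem_singleton_iff]
          omega
        · intro a _ b _ hab
          exact Fin.ext (by simpa using hab)
    _ = 2 * k := by
        rw [Finset.card_erase_of_mem (by simp), Int.card_Icc]
        omega

/-- The adjacency indicator of the path-power graph. -/
def weight (n k : ℕ) (i j : Fin n) : ℝ := if adj n k i j then 1 else 0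

lemma weight_comm (n k : ℕ) (i j : Fin n) : weight n k i j = weight n k j i := by
  simp only [weight, adj_comm n k i j]

lemma weight_nonneg (n k : ℕ) (i j : Fin n) : 0 ≤ weight n k i j := by
  unfold weight
  split_ifs <;> norm_num

lemma sum_weight (n k : ℕ) (i : Fin n) : ∑ j, weight n k i j = deg n k i := by
  simp [weight, deg]

lemma sum_weight_le (n k : ℕ) (i : Fin n) : ∑ j, weight n k i j ≤ 2 * k := by
  rw [sum_weight]
  exact_mod_cast deg_le n k i

lemma lap_mulVec (n k : ℕ) (v : Fin n → ℝ) (i : Fin n) :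
    (lap n k).mulVec v i = ∑ j, weight n k i j * (v i - v j) := by
  have h : ∀ j, lap n k i j = (if i = j then (deg n k i : ℝ) else 0) - weight n k i j := by
    intro j
    by_cases hij : i = j
    · subst hij
      simp [lap, weight, adj]
    · by_cases ha : adj n k i j <;> simp [lap, weight, hij, ha]
  simp only [Matrix.mulVec, dotProduct, h, sub_mul, mul_sub, Finset.sum_sub_distrib,
    ← Finset.sum_mul, sum_weight]
  simp

open Matrix in
lemma dotProduct_lap_mulVec (n k : ℕ) (u v : Fin n → ℝ) :
    u ⬝ᵥ lap n k *ᵥ v = 1 / 2 * ∑ i, ∑ j, weight n k i j * ((u i - u j) * (v i - v j)) := by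
  have h1 : u ⬝ᵥ lap n k *ᵥ v = ∑ i, ∑ j, weight n k i j * (u i * (v i - v j)) := by
    simp only [dotProduct, lap_mulVec, Finset.mul_sum]
    exact Finset.sum_congr rfl fun i _ => Finset.sum_congr rfl fun j _ => by ring
  have h2 : u ⬝ᵥ lap n k *ᵥ v = ∑ i, ∑ j, weight n k i j * (u j * (v j - v i)) := by
    rw [h1, Finset.sum_comm]
    exact Finset.sum_congr rfl fun i _ => Finset.sum_congr rfl fun j _ => by
      rw [weight_comm]
  have h3 : ∑ i, ∑ j, weight n k i j * ((u i - u j) * (v i - v j)) =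
      u ⬝ᵥ lap n k *ᵥ v + u ⬝ᵥ lap n k *ᵥ v := by
    conv_rhs => rw [h1]
    conv_rhs => arg 2; rw [← h1, h2]
    simp only [← Finset.sum_add_distrib]
    exact Finset.sum_congr rfl fun i _ => Finset.sum_congr rfl fun j _ => by ring
  linarith

open Matrix in
lemma lap_mulVec_dotProduct_self_le (n k : ℕ) (v : Fin n → ℝ) :
    lap n k *ᵥ v ⬝ᵥ lap n k *ᵥ v ≤ 4 * k * (v ⬝ᵥ lap n k *ᵥ v) := by
  have h : ∀ i, (lap n k *ᵥ v) i * (lap n k *ᵥ v) i ≤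
      2 * k * ∑ j, weight n k i j * ((v i - v j) * (v i - v j)) := by
    intro i
    have hs : ∀ j, Real.sqrt (weight n k i j) ^ 2 = weight n k i j := fun j =>
      Real.sq_sqrt (weight_nonneg n k i j)
    have hcs := Finset.sum_mul_sq_le_sq_mul_sq Finset.univ (fun j => Real.sqrt (weight n k i j))
      (fun j => Real.sqrt (weight n k i j) * (v i - v j))
    simp only [mul_pow, hs, ← mul_assoc, ← sq] at hcs
    rw [lap_mulVec, ← sq]
    refine hcs.trans ?_
    simp only [← sq]
    exact mul_le_mul_of_nonneg_right (sum_weight_le n k i)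
      (Finset.sum_nonneg fun j _ => mul_nonneg (weight_nonneg n k i j) (sq_nonneg _))
  calc lap n k *ᵥ v ⬝ᵥ lap n k *ᵥ v
      ≤ ∑ i, 2 * k * ∑ j, weight n k i j * ((v i - v j) * (v i - v j)) :=
        Finset.sum_le_sum fun i _ => h i
    _ = 4 * k * (v ⬝ᵥ lap n k *ᵥ v) := by
        rw [dotProduct_lap_mulVec n k v v, ← Finset.mul_sum]
        ring

open Matrix in
lemma Hmat_mulVec (n k : ℕ) (lam : ℝ) (v : Fin n ⊕ Fin n → ℝ) :
    Hmat n k lam *ᵥ v =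
      Sum.elim (lam • lap n k *ᵥ (v ∘ Sum.inl)) (lam • lap n k *ᵥ (v ∘ Sum.inr)) := by
  simp [Hmat, fromBlocks_mulVec, smul_mulVec]

open Matrix in
lemma dotProduct_Hmat_mulVec (n k : ℕ) (lam : ℝ) (u v : Fin n ⊕ Fin n → ℝ) :
    u ⬝ᵥ Hmat n k lam *ᵥ v = lam * ((u ∘ Sum.inl) ⬝ᵥ lap n k *ᵥ (v ∘ Sum.inl) +
      (u ∘ Sum.inr) ⬝ᵥ lap n k *ᵥ (v ∘ Sum.inr)) := by
  rw [Hmat_mulVec]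
  simp only [dotProduct, Fintype.sum_sum_type, Sum.elim_inl, Sum.elim_inr, Pi.smul_apply,
    smul_eq_mul, mul_add, Finset.mul_sum, Function.comp_apply]
  congr 1 <;> exact Finset.sum_congr rfl fun i _ => by ring

open Matrix in
lemma lap_dotProduct_nonneg (n k : ℕ) (v : Fin n → ℝ) : 0 ≤ v ⬝ᵥ lap n k *ᵥ v := by
  rw [dotProduct_lap_mulVec]
  exact mul_nonneg (by norm_num) <| Finset.sum_nonneg fun i _ => Finset.sum_nonneg fun j _ =>
    mul_nonneg (weight_nonneg n k i j) (mul_self_nonneg _)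

open Matrix in
lemma Hmat_dotProduct_nonneg (n k : ℕ) (lam : ℝ) (hlam : 0 ≤ lam) (v : Fin n ⊕ Fin n → ℝ) :
    0 ≤ v ⬝ᵥ Hmat n k lam *ᵥ v := by
  rw [dotProduct_Hmat_mulVec]
  exact mul_nonneg hlam (add_nonneg (lap_dotProduct_nonneg _ _ _) (lap_dotProduct_nonneg _ _ _))

open Matrix in
lemma Hmat_dotProduct_comm (n k : ℕ) (lam : ℝ) (u v : Fin n ⊕ Fin n → ℝ) :
    u ⬝ᵥ Hmat n k lam *ᵥ v = v ⬝ᵥ Hmat n k lam *ᵥ u := by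
  have h : ∀ a b : Fin n → ℝ, a ⬝ᵥ lap n k *ᵥ b = b ⬝ᵥ lap n k *ᵥ a := fun a b => by
    simp only [dotProduct_lap_mulVec, mul_comm (a _ - a _)]
  rw [dotProduct_Hmat_mulVec, dotProduct_Hmat_mulVec, h, h (u ∘ Sum.inr)]

open Matrix in
lemma Hmat_mulVec_dotProduct_self_le (n k : ℕ) (lam : ℝ) (v : Fin n ⊕ Fin n → ℝ) :
    Hmat n k lam *ᵥ v ⬝ᵥ Hmat n k lam *ᵥ v ≤ 4 * lam * k * (v ⬝ᵥ Hmat n k lam *ᵥ v) := by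
  have h1 := lap_mulVec_dotProduct_self_le n k (v ∘ Sum.inl)
  have h2 := lap_mulVec_dotProduct_self_le n k (v ∘ Sum.inr)
  have h3 : Hmat n k lam *ᵥ v ⬝ᵥ Hmat n k lam *ᵥ v = lam ^ 2 *
      (lap n k *ᵥ (v ∘ Sum.inl) ⬝ᵥ lap n k *ᵥ (v ∘ Sum.inl) +
        lap n k *ᵥ (v ∘ Sum.inr) ⬝ᵥ lap n k *ᵥ (v ∘ Sum.inr)) := by
    rw [Hmat_mulVec]
    simp only [sumElim_dotProduct_sumElim, smul_dotProduct, dotProduct_smul, smul_eq_mul]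
    ring
  rw [h3, dotProduct_Hmat_mulVec]
  nlinarith [mul_le_mul_of_nonneg_left (add_le_add h1 h2) (sq_nonneg lam)]

lemma norm_circ (t : ℝ) : ‖circ t‖ = 1 := by
  have : circ t = Complex.exp (((2 * Real.pi * t : ℝ) : ℂ) * Complex.I) := by
    unfold circ; push_cast; ring_nf
  rw [this, Complex.norm_exp_ofReal_mul_I]

lemma norm_circ_sub_le (s t : ℝ) : ‖circ s - circ t‖ ≤ 2 * Real.pi * |s - t| := by
  have h : circ s - circ t =
      circ t * (Complex.exp (Complex.I * ((2 * Real.pi * (s - t) : ℝ) : ℂ)) - 1) := by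
    unfold circ
    rw [mul_sub, ← Complex.exp_add]
    push_cast
    ring_nf
  rw [h, norm_mul, norm_circ, one_mul]
  refine (Real.norm_exp_I_mul_ofReal_sub_one_le).trans_eq ?_
  rw [Real.norm_eq_abs, abs_mul, abs_of_pos Real.two_pi_pos]

open Matrix in
lemma cvec_dotProduct_self (n : ℕ) (t : Fin n → ℝ) : cvec n t ⬝ᵥ cvec n t = n := by
  have h : ∀ i, (circ (t i)).re * (circ (t i)).re + (circ (t i)).im * (circ (t i)).im = 1 := by
    intro i
    rw [← Complex.normSq_apply, Complex.normSq_eq_norm_sq, norm_circ, one_pow]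
  simp only [cvec, embed, sumElim_dotProduct_sumElim]
  simp only [dotProduct, ← Finset.sum_add_distrib, h]
  simp

open Matrix in
/-- Smoothness of the clean signal: a uniform bound `D` on the increments of `t` along edges
bounds the quadratic form of `H` at the embedded signal. -/
lemma quad_cvec_le (n k : ℕ) (lam : ℝ) (hlam : 0 ≤ lam) (t : Fin n → ℝ) (D : ℝ)
    (hD : ∀ i j, adj n k i j → |t i - t j| ≤ D) :
    cvec n t ⬝ᵥ Hmat n k lam *ᵥ cvec n t ≤ lam * (n * k * (2 * Real.pi * D) ^ 2) := by
  rw [dotProduct_Hmat_mulVec, dotProduct_lap_mulVec, dotProduct_lap_mulVec, ← mul_add,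
    ← Finset.sum_add_distrib]
  refine mul_le_mul_of_nonneg_left ?_ hlam
  have hedge : ∀ i, (∑ j, weight n k i j * (((cvec n t ∘ Sum.inl) i - (cvec n t ∘ Sum.inl) j) *
        ((cvec n t ∘ Sum.inl) i - (cvec n t ∘ Sum.inl) j)) +
      ∑ j, weight n k i j * (((cvec n t ∘ Sum.inr) i - (cvec n t ∘ Sum.inr) j) *
        ((cvec n t ∘ Sum.inr) i - (cvec n t ∘ Sum.inr) j))) ≤
      2 * k * (2 * Real.pi * D) ^ 2 := by
    intro i
    refine le_trans ?_ (mul_le_mul_of_nonneg_right (sum_weight_le n k i) (sq_nonneg _))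
    rw [← Finset.sum_add_distrib, Finset.sum_mul]
    refine Finset.sum_le_sum fun j _ => ?_
    by_cases hij : adj n k i j
    · have h1 : ‖circ (t i) - circ (t j)‖ ≤ 2 * Real.pi * D :=
        (norm_circ_sub_le _ _).trans
          (mul_le_mul_of_nonneg_left (hD i j hij) Real.two_pi_pos.le)
      have h2 : ‖circ (t i) - circ (t j)‖ ^ 2 ≤ (2 * Real.pi * D) ^ 2 :=
        pow_le_pow_left₀ (norm_nonneg _) h1 2
      rw [← Complex.normSq_eq_norm_sq, Complex.normSq_apply] at h2
      simpa [weight, hij, cvec, embed] using h2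
    · simp [weight, hij]
  have hsum := Finset.sum_le_sum fun i (_ : i ∈ Finset.univ) => hedge i
  simp only [Finset.sum_const, Finset.card_univ, Fintype.card_fin, nsmul_eq_mul] at hsum
  linarith

lemma gridPt_mem (n : ℕ) (hn : 2 ≤ n) (i : Fin n) : gridPt n i ∈ Set.Icc (0 : ℝ) 1 := by
  have h2 : (2 : ℝ) ≤ n := by exact_mod_cast hn
  have h3 : ((i : ℕ) : ℝ) + 1 ≤ n := by exact_mod_cast i.isLt
  unfold gridPt
  constructor
  · exact div_nonneg (Nat.cast_nonneg _) (by linarith)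
  · rw [div_le_one (by linarith)]
    linarith

lemma abs_gridPt_sub_le (n k : ℕ) (hn : 2 ≤ n) (i j : Fin n) (hij : adj n k i j) :
    |gridPt n i - gridPt n j| ≤ 2 * k / n := by
  have h2 : (2 : ℝ) ≤ n := by exact_mod_cast hn
  have h3 : |((i : ℕ) : ℝ) - ((j : ℕ) : ℝ)| ≤ k := by exact_mod_cast hij.2
  unfold gridPt
  rw [← sub_div, abs_div, abs_of_pos (by linarith : (0 : ℝ) < n - 1),
    div_le_div_iff₀ (by linarith) (by linarith)]
  have hk : (0 : ℝ) ≤ k := Nat.cast_nonneg _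
  nlinarith

end ModOne

open ModOne in
/-- Assume `n ≥ 2` and `‖z̄ − h̄‖₂ ≤ δ√n` for some `δ ∈ [0,1]`. If `z̄` is not
orthogonal to `N(H)`, then (TRS) has a unique global minimizer `ĝ`, and it satisfies
`(1/n)⟨h̄, ĝ⟩ ≥ 1 − 3δ/2 − λπ²M²(2k)^{2α+1}/n^{2α} + (1/(4λk+1)²)·(1/(2n))·z̄ᵀHz̄`. -/
theorem statement6 (n k : ℕ) (hn : 2 ≤ n) (hk₁ : 1 ≤ k) (hk₂ : k ≤ n - 1)
    (lam : ℝ) (hlam : 0 ≤ lam)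
    (f : ℝ → ℝ) (M α : ℝ) (hM : 0 < M) (hα : α ∈ Set.Ioc (0:ℝ) 1)
    (hf : ∀ x ∈ Set.Icc (0:ℝ) 1, ∀ y ∈ Set.Icc (0:ℝ) 1, |f x - f y| ≤ M * |x - y| ^ α)
    (y : Fin n → ℝ) (hy : ∀ i, y i ∈ Set.Ico (0:ℝ) 1)
    (δ : ℝ) (hδ : δ ∈ Set.Icc (0:ℝ) 1)
    (hnoise : norm2 n (cvec n y - cvec n (fun i => f (gridPt n i))) ≤ δ * Real.sqrt n)
    (hperp : ¬ perpNull n k lam (cvec n y)) :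
    ∃ g, minimizer n k lam (cvec n y) g ∧
      (∀ g', minimizer n k lam (cvec n y) g' → g' = g) ∧
      (1 / (n:ℝ)) * dotR n (cvec n (fun i => f (gridPt n i))) g ≥
        1 - 3 * δ / 2
          - lam * Real.pi ^ 2 * M ^ 2 * (2 * (k:ℝ)) ^ (2 * α + 1) / (n:ℝ) ^ (2 * α)
          + (1 / (4 * lam * (k:ℝ) + 1) ^ 2) *
              ((1 / (2 * (n:ℝ))) * quad n (Hmat n k lam) (cvec n y)) := by
  set z := cvec n y with hz
  set h := cvec n (fun i => f (gridPt n i)) with hh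
  set A := Hmat n k lam with hA
  have hn0 : (0 : ℝ) < n := by exact_mod_cast (by omega : 0 < n)
  have hquad : ∀ v, quad n A v = v ⬝ᵥ A.mulVec v := fun v => rfl
  have hdot : ∀ u v, dotR n u v = u ⬝ᵥ v := fun u v => rfl
  have hfeas : ∀ v, feasible n v ↔ v ⬝ᵥ v = n := fun v => by
    simp only [feasible, dotProduct, sq]
  have hsymm : ∀ u v, u ⬝ᵥ A.mulVec v = v ⬝ᵥ A.mulVec u := Hmat_dotProduct_comm n k lam
  have hpos : ∀ v, 0 ≤ v ⬝ᵥ A.mulVec v := Hmat_dotProduct_nonneg n k lam hlam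
  have hzz : z ⬝ᵥ z = n := cvec_dotProduct_self n y
  have hhh : h ⬝ᵥ h = n := cvec_dotProduct_self n _
  obtain ⟨v, hv, hzv⟩ : ∃ v, A.mulVec v = 0 ∧ z ⬝ᵥ v ≠ 0 := by
    simpa only [perpNull, not_forall, exists_prop, hdot] using hperp
  obtain ⟨μ, hμ0, hμ1, g, hg, hgg⟩ :=
    exists_shift_solution_of_dotProduct_ne_zero A hsymm hpos z v hv hzv
  rw [hzz] at hgg
  have hgap : ∀ g', feasible n g' → objective n k lam z g' =
      objective n k lam z g + (g' - g) ⬝ᵥ A.mulVec (g' - g) + μ * ((g' - g) ⬝ᵥ (g' - g)) := by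
    intro g' hg'
    rw [hfeas] at hg'
    have e1 : g' ⬝ᵥ z = g' ⬝ᵥ A.mulVec g + μ * (g' ⬝ᵥ g) := by
      rw [← hg, dotProduct_add, dotProduct_smul, smul_eq_mul]
    have e2 : g ⬝ᵥ z = g ⬝ᵥ A.mulVec g + μ * (g ⬝ᵥ g) := by
      rw [← hg, dotProduct_add, dotProduct_smul, smul_eq_mul]
    simp only [objective, ← hA, hquad, hdot, e1, e2, Matrix.mulVec_sub, dotProduct_sub, sub_dotProduct,
      hsymm g g', dotProduct_comm g g', hgg, hg']
    ring
  have hself : ∀ w : Fin n ⊕ Fin n → ℝ, 0 ≤ w ⬝ᵥ w := fun w =>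
    Finset.sum_nonneg fun i _ => mul_self_nonneg (w i)
  have hgfeas : feasible n g := (hfeas g).mpr hgg
  have hmin : minimizer n k lam z g := by
    refine ⟨hgfeas, fun g' hg' => ?_⟩
    rw [hgap g' hg']
    linarith [hpos (g' - g), mul_nonneg hμ0.le (hself (g' - g))]
  refine ⟨g, hmin, fun g' hg' => ?_, ?_⟩
  · have h1 := hg'.2 g hgfeas
    rw [hgap g' hg'.1] at h1
    have h2 := hpos (g' - g)
    have h3 : (g' - g) ⬝ᵥ (g' - g) = 0 := by
      have := hself (g' - g)
      nlinarith
    exact sub_eq_zero.mp (dotProduct_self_eq_zero.mp h3)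
  · have hnoise' : (z - h) ⬝ᵥ (z - h) ≤ δ ^ 2 * n := by
      have h1 : norm2 n (z - h) ^ 2 = (z - h) ⬝ᵥ (z - h) := by
        rw [norm2, Real.sq_sqrt (Finset.sum_nonneg fun i _ => sq_nonneg _)]
        simp only [dotProduct, sq]
      have h2 : norm2 n (z - h) ^ 2 ≤ (δ * Real.sqrt n) ^ 2 :=
        pow_le_pow_left₀ (Real.sqrt_nonneg _) hnoise 2
      rwa [h1, mul_pow, Real.sq_sqrt hn0.le] at h2
    have hhz : n * (1 - δ / 2) ≤ h ⬝ᵥ z := by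
      have e : (z - h) ⬝ᵥ (z - h) = n + n - 2 * (h ⬝ᵥ z) := by
        simp only [dotProduct_sub, sub_dotProduct, hzz, hhh, dotProduct_comm z h]
        ring
      have : δ ^ 2 ≤ δ := by nlinarith [hδ.1, hδ.2]
      nlinarith
    have hcs : (z - h) ⬝ᵥ g ≤ δ * n := by
      have h1 : ((z - h) ⬝ᵥ g) ^ 2 ≤ ((z - h) ⬝ᵥ (z - h)) * (g ⬝ᵥ g) := by
        simpa [dotProduct, sq] using Finset.sum_mul_sq_le_sq_mul_sq Finset.univ (z - h) g
      refine le_of_sq_le_sq ?_ (mul_nonneg hδ.1 hn0.le)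
      rw [hgg] at h1
      nlinarith
    have hopt := hmin.2 h ((hfeas h).mpr hhh)
    simp only [objective, ← hA, hquad, hdot] at hopt
    have hclean : h ⬝ᵥ A.mulVec h ≤
        lam * (n * k * (2 * Real.pi * (M * (2 * k / n : ℝ) ^ α)) ^ 2) := by
      refine quad_cvec_le n k lam hlam _ _ fun i j hij => ?_
      refine (hf _ (gridPt_mem n hn i) _ (gridPt_mem n hn j)).trans ?_
      exact mul_le_mul_of_nonneg_left
        (Real.rpow_le_rpow (abs_nonneg _) (abs_gridPt_sub_le n k hn i j hij) hα.1.le) hM.le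
    have hclean' : lam * (n * k * (2 * Real.pi * (M * (2 * k / n : ℝ) ^ α)) ^ 2) =
        2 * n * (lam * Real.pi ^ 2 * M ^ 2 * (2 * (k : ℝ)) ^ (2 * α + 1) / (n : ℝ) ^ (2 * α)) := by
      have hk0 : (0 : ℝ) < 2 * k := by positivity
      have e1 : ((2 * k / n : ℝ) ^ α) ^ 2 = (2 * (k : ℝ)) ^ (2 * α) / (n : ℝ) ^ (2 * α) := by
        rw [← Real.rpow_natCast, ← Real.rpow_mul (by positivity),
          Real.div_rpow hk0.le hn0.le]
        norm_num [mul_comm]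
      rw [Real.rpow_add_one hk0.ne', mul_pow, mul_pow M, e1]
      ring
    have hsmooth : z ⬝ᵥ A.mulVec z ≤ (4 * lam * k + 1) ^ 2 * (g ⬝ᵥ A.mulVec g) := by
      have hc : 0 ≤ 4 * lam * k := by positivity
      refine (dotProduct_mulVec_le_of_shift A (4 * lam * k) μ hc hμ0.le hsymm
        (Hmat_mulVec_dotProduct_self_le n k lam) g z hg).trans ?_
      exact mul_le_mul_of_nonneg_right
        (pow_le_pow_left₀ (by linarith) (by linarith) 2) (hpos g)
    have hfinal : 1 / (4 * lam * (k : ℝ) + 1) ^ 2 * (z ⬝ᵥ A.mulVec z) ≤ g ⬝ᵥ A.mulVec g := by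
      rw [one_div, inv_mul_le_iff₀ (by positivity)]
      exact hsmooth
    rw [hclean'] at hclean
    rw [hquad, hdot]
    have hsplit : h ⬝ᵥ g = g ⬝ᵥ z - (z - h) ⬝ᵥ g := by
      rw [sub_dotProduct, dotProduct_comm z g]
      ring
    set B := lam * Real.pi ^ 2 * M ^ 2 * (2 * (k : ℝ)) ^ (2 * α + 1) / (n : ℝ) ^ (2 * α)
    set C := 1 / (4 * lam * (k : ℝ) + 1) ^ 2
    rw [ge_iff_le, one_div_mul_eq_div (n : ℝ) (h ⬝ᵥ g), le_div_iff₀ hn0]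
    have e : (1 - 3 * δ / 2 - B + C * (1 / (2 * n) * (z ⬝ᵥ A.mulVec z))) * n =
        n * (1 - 3 * δ / 2) - n * B + C * (z ⬝ᵥ A.mulVec z) / 2 := by
      field_simp
    rw [e, hsplit]
    linarith
end
end

section
/- If m ≥ 2, then (1/(2n))·h̄ᵀHh̄ ≤ λπ²M²(2k)^{2α}·d^{2α}·((2k+1)^d − 1)/n^{2α/d}. -/
open scoped BigOperators
noncomputable section

namespace ModOneMulti

/-- Index set of the `d`-dimensional grid: `V = {1,…,m}^d`. -/
abbrev V (d m : ℕ) := Fin d → Fin m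

/-- Grid point `x_𝐢 ∈ [0,1]^d` indexed by `𝐢 ∈ V`. -/
def gridPt (d m : ℕ) (i : V d m) : Fin d → ℝ := fun t => (i t : ℝ) / ((m : ℝ) - 1)

/-- Adjacency: `𝐢 ≠ 𝐣` and `‖𝐢 − 𝐣‖_∞ ≤ k`. -/
def adj (d m k : ℕ) (i j : V d m) : Prop :=
  i ≠ j ∧ ∀ t, |(i t : ℤ) - (j t : ℤ)| ≤ (k : ℤ)

instance adjDec (d m k : ℕ) (i : V d m) : DecidablePred (adj d m k i) := fun j =>
  inferInstanceAs (Decidable (i ≠ j ∧ ∀ t, |(i t : ℤ) - (j t : ℤ)| ≤ (k : ℤ)))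

/-- Degree of vertex `𝐢` in the graph `G`. -/
def deg (d m k : ℕ) (i : V d m) : ℕ := (Finset.univ.filter (adj d m k i)).card

/-- The graph Laplacian `L` of `G`. -/
def lap (d m k : ℕ) : Matrix (V d m) (V d m) ℝ := fun i j =>
  if i = j then (deg d m k i : ℝ) else if adj d m k i j then -1 else 0

/-- The block-diagonal matrix `H` with both diagonal blocks equal to `λL`. -/
def Hmat (d m k : ℕ) (lam : ℝ) : Matrix (V d m ⊕ V d m) (V d m ⊕ V d m) ℝ :=
  Matrix.fromBlocks (lam • lap d m k) 0 0 (lam • lap d m k)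

/-- The angular embedding `circ t = exp(2πι t)`. -/
def circ (t : ℝ) : ℂ := Complex.exp (2 * Real.pi * Complex.I * (t : ℂ))

/-- Real representation `(Re v, Im v) ∈ ℝ^{2n}` of a complex vector `v ∈ ℂ^n`. -/
def embed (d m : ℕ) (v : V d m → ℂ) : V d m ⊕ V d m → ℝ :=
  Sum.elim (fun i => (v i).re) (fun i => (v i).im)

/-- Real representation of the angular embedding of values `t : V → ℝ`. -/
def cvec (d m : ℕ) (t : V d m → ℝ) : V d m ⊕ V d m → ℝ := embed d m (fun i => circ (t i))

/-- Quadratic form `vᵀ A v`. -/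
def quad (d m : ℕ) (A : Matrix (V d m ⊕ V d m) (V d m ⊕ V d m) ℝ)
    (v : V d m ⊕ V d m → ℝ) : ℝ := ∑ i, v i * A.mulVec v i

/-- Euclidean inner product on `ℝ^{2n}`. -/
def dotR (d m : ℕ) (u v : V d m ⊕ V d m → ℝ) : ℝ := ∑ i, u i * v i

/-- Euclidean norm on `ℝ^{2n}`. -/
def norm2 (d m : ℕ) (v : V d m ⊕ V d m → ℝ) : ℝ := Real.sqrt (∑ i, (v i) ^ 2)

/-- Feasibility for (TRS): `‖g‖₂² = n` with `n = m^d`. -/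
def feasible (d m : ℕ) (g : V d m ⊕ V d m → ℝ) : Prop := ∑ i, (g i) ^ 2 = ((m : ℝ)) ^ d

/-- The (TRS) objective `ḡᵀHḡ − 2ḡᵀz̄`. -/
def objective (d m k : ℕ) (lam : ℝ) (zbar g : V d m ⊕ V d m → ℝ) : ℝ :=
  quad d m (Hmat d m k lam) g - 2 * dotR d m g zbar

/-- `g` is a global minimizer of (TRS) with data `z̄`. -/
def minimizer (d m k : ℕ) (lam : ℝ) (zbar g : V d m ⊕ V d m → ℝ) : Prop :=
  feasible d m g ∧
    ∀ g', feasible d m g' → objective d m k lam zbar g ≤ objective d m k lam zbar g'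

/-- `z̄` is orthogonal to the null space `N(H)` of `H`. -/
def perpNull (d m k : ℕ) (lam : ℝ) (z : V d m ⊕ V d m → ℝ) : Prop :=
  ∀ v, (Hmat d m k lam).mulVec v = 0 → dotR d m z v = 0

/-- Euclidean norm on `ℝ^d`. -/
def enorm (d : ℕ) (x : Fin d → ℝ) : ℝ := Real.sqrt (∑ t, (x t) ^ 2)

end ModOneMulti

namespace ModOneMulti

variable {d m k : ℕ}

theorem adj_comm (i j : V d m) : adj d m k i j ↔ adj d m k j i := by
  simp only [adj, abs_sub_comm, ne_comm]

theorem lap_mulVec_apply (v : V d m → ℝ) (i : V d m) :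
    (lap d m k).mulVec v i = ∑ j, if adj d m k i j then v i - v j else 0 := by
  have key : ∀ j, lap d m k i j * v j =
      (if i = j then (deg d m k i : ℝ) * v i else 0) - if adj d m k i j then v j else 0 := by
    intro j
    by_cases hij : i = j
    · subst hij
      simp [lap, adj]
    · by_cases ha : adj d m k i j <;> simp [lap, hij, ha]
  have hdeg : ∑ j, (if adj d m k i j then v i else 0) = (deg d m k i : ℝ) * v i := by
    rw [← Finset.sum_filter, Finset.sum_const, nsmul_eq_mul, deg]
  simp only [Matrix.mulVec, dotProduct, key]
  rw [Finset.sum_sub_distrib, Finset.sum_ite_eq, if_pos (Finset.mem_univ _), ← hdeg,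
    ← Finset.sum_sub_distrib]
  refine Finset.sum_congr rfl fun j _ => ?_
  split_ifs <;> simp

theorem sum_mul_lap_mulVec (v : V d m → ℝ) :
    ∑ i, v i * (lap d m k).mulVec v i =
      (1 / 2) * ∑ i, ∑ j, if adj d m k i j then (v i - v j) ^ 2 else 0 := by
  have h1 : ∑ i, v i * (lap d m k).mulVec v i =
      ∑ i, ∑ j, if adj d m k i j then v i * (v i - v j) else 0 := by
    simp only [lap_mulVec_apply, Finset.mul_sum, mul_ite, mul_zero]
  have h2 : ∑ i, ∑ j, (if adj d m k i j then v i * (v i - v j) else 0) =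
      ∑ i, ∑ j, if adj d m k i j then v j * (v j - v i) else 0 := by
    rw [Finset.sum_comm]
    simp only [adj_comm]
  have h3 : ∑ i, ∑ j, (if adj d m k i j then (v i - v j) ^ 2 else 0) =
      ∑ i, ∑ j, (if adj d m k i j then v i * (v i - v j) else 0) +
      ∑ i, ∑ j, if adj d m k i j then v j * (v j - v i) else 0 := by
    simp only [← Finset.sum_add_distrib]
    refine Finset.sum_congr rfl fun i _ => Finset.sum_congr rfl fun j _ => ?_
    split_ifs <;> ring
  rw [h1, h3, ← h2]
  ring

theorem quad_Hmat_embed (lam : ℝ) (v : V d m → ℂ) :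
    quad d m (Hmat d m k lam) (embed d m v) =
      (lam / 2) * ∑ i, ∑ j,
        if adj d m k i j then ((v i).re - (v j).re) ^ 2 + ((v i).im - (v j).im) ^ 2 else 0 := by
  have h : quad d m (Hmat d m k lam) (embed d m v) =
      lam * (∑ i, (v i).re * (lap d m k).mulVec (fun i => (v i).re) i) +
      lam * (∑ i, (v i).im * (lap d m k).mulVec (fun i => (v i).im) i) := by
    simp only [quad, Hmat, embed, Fintype.sum_sum_type, Matrix.fromBlocks_mulVec, Sum.elim_inl,
      Sum.elim_inr, Sum.elim_comp_inl, Sum.elim_comp_inr, Matrix.zero_mulVec, add_zero, zero_add,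
      Matrix.smul_mulVec, Pi.smul_apply, smul_eq_mul, Finset.mul_sum]
    congr 1 <;> exact Finset.sum_congr rfl fun i _ => by ring
  have hs : ∑ i, ∑ j, (if adj d m k i j then
        ((v i).re - (v j).re) ^ 2 + ((v i).im - (v j).im) ^ 2 else 0) =
      ∑ i, ∑ j, (if adj d m k i j then ((v i).re - (v j).re) ^ 2 else 0) +
      ∑ i, ∑ j, (if adj d m k i j then ((v i).im - (v j).im) ^ 2 else 0) := by
    simp only [← Finset.sum_add_distrib]
    refine Finset.sum_congr rfl fun i _ => Finset.sum_congr rfl fun j _ => ?_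
    split_ifs <;> simp
  rw [h, hs, sum_mul_lap_mulVec, sum_mul_lap_mulVec]
  ring

theorem deg_le (i : V d m) : (deg d m k i : ℝ) ≤ (2 * (k : ℝ) + 1) ^ d - 1 := by
  have hcoord : ∀ a : Fin m,
      (Finset.univ.filter fun b : Fin m => |(a : ℤ) - (b : ℤ)| ≤ (k : ℤ)).card ≤ 2 * k + 1 := by
    intro a
    have hcard : (Finset.Icc ((a : ℤ) - k) ((a : ℤ) + k)).card = 2 * k + 1 := by
      rw [Int.card_Icc]
      omega
    rw [← hcard]
    refine Finset.card_le_card_of_injOn (fun b : Fin m => (b : ℤ)) ?_ ?_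
    · intro b hb
      have hb' : |(a : ℤ) - (b : ℤ)| ≤ (k : ℤ) := by simpa using hb
      rw [abs_le] at hb'
      simp only [Finset.coe_Icc, Set.mem_Icc]
      omega
    · intro b _ c _ hbc
      exact Fin.ext (by simpa using hbc)
  have hsub : insert i (Finset.univ.filter (adj d m k i)) ⊆ Fintype.piFinset fun t =>
      Finset.univ.filter fun b : Fin m => |(i t : ℤ) - (b : ℤ)| ≤ (k : ℤ) := by
    intro j hj
    rw [Fintype.mem_piFinset]
    intro t
    rcases Finset.mem_insert.1 hj with rfl | hj
    · simp
    · simpa using (Finset.mem_filter.1 hj).2.2 t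
  have hnat : deg d m k i + 1 ≤ (2 * k + 1) ^ d := by
    calc deg d m k i + 1 = (insert i (Finset.univ.filter (adj d m k i))).card := by
          rw [Finset.card_insert_of_notMem (by simp [adj]), deg]
      _ ≤ _ := Finset.card_le_card hsub
      _ ≤ ∏ _t : Fin d, (2 * k + 1) := by
          rw [Fintype.card_piFinset]
          exact Finset.prod_le_prod' fun t _ => hcoord (i t)
      _ = (2 * k + 1) ^ d := by simp
  have : (deg d m k i : ℝ) + 1 ≤ (2 * (k : ℝ) + 1) ^ d := by exact_mod_cast hnat
  linarith

theorem circ_re (t : ℝ) : (circ t).re = Real.cos (2 * Real.pi * t) := by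
  rw [circ, ← Complex.exp_ofReal_mul_I_re]
  congr 2
  push_cast
  ring

theorem circ_im (t : ℝ) : (circ t).im = Real.sin (2 * Real.pi * t) := by
  rw [circ, ← Complex.exp_ofReal_mul_I_im]
  congr 2
  push_cast
  ring

theorem circ_sub_sq_le (s t : ℝ) :
    ((circ s).re - (circ t).re) ^ 2 + ((circ s).im - (circ t).im) ^ 2 ≤
      4 * Real.pi ^ 2 * |s - t| ^ 2 := by
  simp only [circ_re, circ_im, sq_abs]
  have h := Real.one_sub_sq_div_two_le_cos (x := 2 * Real.pi * s - 2 * Real.pi * t)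
  rw [Real.cos_sub] at h
  nlinarith [Real.sin_sq_add_cos_sq (2 * Real.pi * s), Real.sin_sq_add_cos_sq (2 * Real.pi * t)]

theorem gridPt_mem_Icc (hm : 2 ≤ m) (i : V d m) (t : Fin d) :
    gridPt d m i t ∈ Set.Icc (0 : ℝ) 1 := by
  have hm' : (2 : ℝ) ≤ m := by exact_mod_cast hm
  have hi : ((i t : ℕ) : ℝ) + 1 ≤ m := by exact_mod_cast (i t).isLt
  refine ⟨div_nonneg (Nat.cast_nonneg _) (by linarith), ?_⟩
  rw [gridPt, div_le_one (by linarith)]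
  linarith

theorem enorm_gridPt_sub_le (hd : 1 ≤ d) (hm : 2 ≤ m) {i j : V d m} (hij : adj d m k i j) :
    enorm d (gridPt d m i - gridPt d m j) ≤ d * (2 * k / m) := by
  have hm' : (2 : ℝ) ≤ m := by exact_mod_cast hm
  have hd' : (1 : ℝ) ≤ d := by exact_mod_cast hd
  have hcoord : ∀ t, ((gridPt d m i - gridPt d m j) t) ^ 2 ≤ (2 * (k : ℝ) / m) ^ 2 := by
    intro t
    have hk : |((i t : ℕ) : ℝ) - ((j t : ℕ) : ℝ)| ≤ k := by exact_mod_cast hij.2 t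
    refine sq_le_sq.2 ?_
    rw [Pi.sub_apply, gridPt, gridPt, ← sub_div, abs_div, abs_of_pos (by linarith : (0 : ℝ) < m - 1),
      abs_of_nonneg (by positivity : (0 : ℝ) ≤ 2 * k / m),
      div_le_div_iff₀ (by linarith) (by linarith)]
    nlinarith [(Nat.cast_nonneg k : (0 : ℝ) ≤ k)]
  rw [enorm]
  refine Real.sqrt_le_iff.2 ⟨by positivity, ?_⟩
  calc _ ≤ ∑ _t : Fin d, (2 * (k : ℝ) / m) ^ 2 := Finset.sum_le_sum fun t _ => hcoord t
    _ = d * (2 * (k : ℝ) / m) ^ 2 := by simp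
    _ ≤ (d * (2 * (k : ℝ) / m)) ^ 2 := by
        rw [mul_pow]
        gcongr
        nlinarith

end ModOneMulti

open ModOneMulti in
/-- If `m ≥ 2`, then
`(1/(2n))·h̄ᵀHh̄ ≤ λπ²M²(2k)^{2α}·d^{2α}·((2k+1)^d − 1)/n^{2α/d}` where `n = m^d` and
`f : [0,1]^d → ℝ` is `(M,α)`-Hölder w.r.t. the Euclidean norm. -/
theorem statement18 (d m k : ℕ) (hd : 1 ≤ d) (hm : 2 ≤ m) (hk₁ : 1 ≤ k) (hk₂ : k ≤ m - 1)
    (lam : ℝ) (hlam : 0 ≤ lam)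
    (f : (Fin d → ℝ) → ℝ) (M α : ℝ) (hM : 0 < M) (hα : α ∈ Set.Ioc (0:ℝ) 1)
    (hf : ∀ x y : Fin d → ℝ, (∀ t, x t ∈ Set.Icc (0:ℝ) 1) → (∀ t, y t ∈ Set.Icc (0:ℝ) 1) →
      |f x - f y| ≤ M * (enorm d (x - y)) ^ α) :
    (1 / (2 * ((m:ℝ)) ^ d)) *
        quad d m (Hmat d m k lam) (cvec d m (fun i => f (gridPt d m i))) ≤
      lam * Real.pi ^ 2 * M ^ 2 * (2 * (k:ℝ)) ^ (2 * α) * (d:ℝ) ^ (2 * α)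
        * ((2 * (k:ℝ) + 1) ^ d - 1) / ((m:ℝ) ^ d) ^ (2 * α / (d:ℝ)) := by
  have hm0 : (0 : ℝ) < m := by exact_mod_cast (by omega : 0 < m)
  have hd0 : (d : ℝ) ≠ 0 := by exact_mod_cast (by omega : d ≠ 0)
  set B : ℝ := 4 * Real.pi ^ 2 * (M * ((d : ℝ) * (2 * k / m)) ^ α) ^ 2 with hB
  have hB0 : 0 ≤ B := by positivity
  have hterm : ∀ i j, adj d m k i j →
      ((circ (f (gridPt d m i))).re - (circ (f (gridPt d m j))).re) ^ 2 +
        ((circ (f (gridPt d m i))).im - (circ (f (gridPt d m j))).im) ^ 2 ≤ B := by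
    intro i j hij
    refine (circ_sub_sq_le _ _).trans ?_
    have hfij := hf _ _ (gridPt_mem_Icc hm i) (gridPt_mem_Icc hm j)
    have he := Real.rpow_le_rpow (Real.sqrt_nonneg _) (enorm_gridPt_sub_le hd hm hij) hα.1.le
    have hle := hfij.trans (mul_le_mul_of_nonneg_left he hM.le)
    rw [hB]
    gcongr
  have hsum : ∑ i, ∑ j, (if adj d m k i j then
      ((circ (f (gridPt d m i))).re - (circ (f (gridPt d m j))).re) ^ 2 +
        ((circ (f (gridPt d m i))).im - (circ (f (gridPt d m j))).im) ^ 2 else 0) ≤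
      (m : ℝ) ^ d * (((2 * (k : ℝ) + 1) ^ d - 1) * B) := by
    calc _ ≤ ∑ i : V d m, ∑ j, (if adj d m k i j then B else 0) := by
          refine Finset.sum_le_sum fun i _ => Finset.sum_le_sum fun j _ => ?_
          split_ifs with h
          exacts [hterm i j h, le_rfl]
      _ = ∑ i : V d m, (deg d m k i : ℝ) * B := by
          simp only [← Finset.sum_filter, Finset.sum_const, nsmul_eq_mul, deg]
      _ ≤ ∑ _i : V d m, ((2 * (k : ℝ) + 1) ^ d - 1) * B :=
          Finset.sum_le_sum fun i _ => mul_le_mul_of_nonneg_right (deg_le i) hB0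
      _ = _ := by simp
  have hpow : ((m : ℝ) ^ d) ^ (2 * α / (d : ℝ)) = (m : ℝ) ^ (2 * α) := by
    rw [← Real.rpow_natCast, ← Real.rpow_mul hm0.le, mul_div_cancel₀ _ hd0]
  have hBeq : B = 4 * Real.pi ^ 2 * M ^ 2 *
      ((d : ℝ) ^ (2 * α) * ((2 * (k : ℝ)) ^ (2 * α) / (m : ℝ) ^ (2 * α))) := by
    rw [hB, mul_pow, ← Real.rpow_natCast (_ ^ α), ← Real.rpow_mul (by positivity), Nat.cast_ofNat,
      mul_comm α 2, Real.mul_rpow (by positivity) (by positivity),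
      Real.div_rpow (by positivity) hm0.le]
    ring
  rw [cvec, quad_Hmat_embed, hpow]
  calc _ ≤ 1 / (2 * (m : ℝ) ^ d) *
        (lam / 2 * ((m : ℝ) ^ d * (((2 * (k : ℝ) + 1) ^ d - 1) * B))) := by gcongr
    _ = _ := by
        rw [hBeq]
        have := (pow_pos hm0 d).ne'
        have := (Real.rpow_pos_of_pos hm0 (2 * α)).ne'
        field_simp
        ring
end
end
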